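/- arXiv:2310.18888 — 2 statements merged into one kernel-verified Lean document; each statement's English description precedes it below -/
import Mathlib

section
/- Let g : ℝ → ℝ be a Tauber-Wiener function, H ⊂ ℝ^d a compact set, and U ⊂ C(H) a compact set of continuous real-valued functions on H. Then for every ε > 0 there exist a positive integer K (independent of the individual f ∈ U), continuous linear functionals c_1, …, c_K on C(H), weight vectors w_1, …, w_K ∈ ℝ^d, and biases p_1, …, p_K ∈ ℝ, such that for every f ∈ U and every y ∈ H, |f(y) − ∑_{k=1}^K c_k(f) · g(w_k · y + p_k)| < ε. -/
/-- A function `g : ℝ → ℝ` is a Tauber-Wiener function if every continuous function on a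
compact interval can be uniformly approximated by finite linear combinations
`∑ i, c i * g (λ i * x + θ i)`. -/
def IsTauberWiener (g : ℝ → ℝ) : Prop :=
  ∀ (a b : ℝ) (f : ℝ → ℝ), ContinuousOn f (Set.Icc a b) → ∀ ε : ℝ, 0 < ε →
    ∃ (N : ℕ), 0 < N ∧ ∃ (c lam θ : Fin N → ℝ),
      ∀ x ∈ Set.Icc a b, |f x - ∑ i, c i * g (lam i * x + θ i)| < ε

/-- The linear span of the ridge units `y ↦ g (w ⬝ y + p)`, as functions on `H`. -/
def ridgeSpan {d : ℕ} (g : ℝ → ℝ) (H : Set (Fin d → ℝ)) : Submodule ℝ (H → ℝ) :=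
  Submodule.span ℝ (Set.range fun (q : (Fin d → ℝ) × ℝ) (y : H) =>
    g ((∑ j, q.1 j * (y : Fin d → ℝ) j) + q.2))

/-- The exponential ridge function `y ↦ exp (w ⬝ y)` on `H`. -/
noncomputable def expRidge {d : ℕ} (H : Set (Fin d → ℝ)) (w : Fin d → ℝ) : C(H, ℝ) where
  toFun y := Real.exp (∑ j, w j * (y : Fin d → ℝ) j)
  continuous_toFun := Real.continuous_exp.comp <| continuous_finsetSum _ fun j _ =>
    continuous_const.mul ((continuous_apply j).comp continuous_subtype_val)

theorem expRidge_mul {d : ℕ} (H : Set (Fin d → ℝ)) (v w : Fin d → ℝ) :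
    expRidge H v * expRidge H w = expRidge H (v + w) := by
  ext y
  simp [expRidge, ← Real.exp_add, add_mul, Finset.sum_add_distrib]

theorem expRidge_zero {d : ℕ} (H : Set (Fin d → ℝ)) : expRidge H 0 = 1 := by
  ext y
  simp [expRidge]

/-- The exponential ridge functions form a multiplicative submonoid of `C(H, ℝ)`. -/
noncomputable def expRidgeSubmonoid {d : ℕ} (H : Set (Fin d → ℝ)) : Submonoid C(H, ℝ) where
  carrier := Set.range (expRidge H)
  mul_mem' := by
    rintro _ _ ⟨v, rfl⟩ ⟨w, rfl⟩
    exact ⟨v + w, (expRidge_mul H v w).symm⟩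
  one_mem' := ⟨0, expRidge_zero H⟩

theorem separatesPoints_adjoin_expRidge {d : ℕ} (H : Set (Fin d → ℝ)) :
    (Algebra.adjoin ℝ (expRidgeSubmonoid H : Set C(H, ℝ))).SeparatesPoints := by
  intro x y hxy
  obtain ⟨j, hj⟩ : ∃ j, (x : Fin d → ℝ) j ≠ (y : Fin d → ℝ) j := by
    by_contra! h
    exact hxy (Subtype.ext (funext h))
  refine ⟨expRidge H (Pi.single j 1),
    ⟨_, Algebra.subset_adjoin ⟨Pi.single j 1, rfl⟩, rfl⟩, ?_⟩
  simpa [expRidge, Pi.single_apply] using hj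

theorem exists_ridgeSpan_near_expRidge {d : ℕ} {g : ℝ → ℝ} (hg : IsTauberWiener g)
    {H : Set (Fin d → ℝ)} (hH : IsCompact H) (w : Fin d → ℝ) {ε : ℝ} (hε : 0 < ε) :
    ∃ n ∈ ridgeSpan g H, ∀ y, |expRidge H w y - n y| < ε := by
  obtain ⟨R, hR⟩ := hH.exists_bound_of_continuousOn
    (f := fun y : Fin d → ℝ => ∑ j, w j * y j) (by fun_prop)
  obtain ⟨N, -, c, lam, θ, h⟩ :=
    hg (-R) R Real.exp Real.continuous_exp.continuousOn ε hε
  refine ⟨∑ i, c i • fun y : H => g ((∑ j, (lam i • w) j * (y : Fin d → ℝ) j) + θ i),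
    Submodule.sum_mem _ fun i _ => Submodule.smul_mem _ _
      (Submodule.subset_span ⟨(lam i • w, θ i), rfl⟩), fun y => ?_⟩
  have := h _ (abs_le.mp (hR y y.2))
  simpa [expRidge, Finset.mul_sum, mul_assoc] using this

theorem exists_ridgeSpan_near_of_mem_span {d : ℕ} {g : ℝ → ℝ} (hg : IsTauberWiener g)
    {H : Set (Fin d → ℝ)} (hH : IsCompact H) {φ : C(H, ℝ)}
    (hφ : φ ∈ Submodule.span ℝ (Set.range (expRidge H))) {ε : ℝ} (hε : 0 < ε) :
    ∃ n ∈ ridgeSpan g H, ∀ y, |φ y - n y| < ε := by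
  induction hφ using Submodule.span_induction generalizing ε with
  | mem φ h =>
    obtain ⟨w, rfl⟩ := h
    exact exists_ridgeSpan_near_expRidge hg hH w hε
  | zero => exact ⟨0, zero_mem _, fun y => by simpa using hε⟩
  | add φ ψ _ _ ihφ ihψ =>
    obtain ⟨m, hm, hm'⟩ := ihφ (half_pos hε)
    obtain ⟨n, hn, hn'⟩ := ihψ (half_pos hε)
    refine ⟨m + n, add_mem hm hn, fun y => ?_⟩
    have h₁ := abs_lt.mp (hm' y)
    have h₂ := abs_lt.mp (hn' y)
    simp only [ContinuousMap.add_apply, Pi.add_apply]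
    rw [abs_lt]
    constructor <;> linarith
  | smul a φ _ ih =>
    have ha : 0 < |a| + 1 := by positivity
    obtain ⟨n, hn, hn'⟩ := ih (div_pos hε ha)
    refine ⟨a • n, Submodule.smul_mem _ _ hn, fun y => ?_⟩
    have h := hn' y
    rw [lt_div_iff₀ ha] at h
    simp only [ContinuousMap.smul_apply, Pi.smul_apply, smul_eq_mul, ← mul_sub, abs_mul]
    nlinarith [abs_nonneg (φ y - n y)]

/-- Single-function universal approximation by one-hidden-layer networks. -/
theorem exists_ridgeSpan_near {d : ℕ} {g : ℝ → ℝ} (hg : IsTauberWiener g)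
    {H : Set (Fin d → ℝ)} (hH : IsCompact H) (φ : C(H, ℝ)) {ε : ℝ} (hε : 0 < ε) :
    ∃ n ∈ ridgeSpan g H, ∀ y, |φ y - n y| < ε := by
  have : CompactSpace H := isCompact_iff_compactSpace.mp hH
  obtain ⟨⟨ψ, hψ⟩, hψφ⟩ := ContinuousMap.exists_mem_subalgebra_near_continuousMap_of_separatesPoints
    _ (separatesPoints_adjoin_expRidge H) φ (ε / 2) (half_pos hε)
  rw [← Subalgebra.mem_toSubmodule, Algebra.adjoin_eq_span, Submonoid.closure_eq] at hψ
  obtain ⟨n, hn, hn'⟩ := exists_ridgeSpan_near_of_mem_span hg hH hψ (half_pos hε)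
  refine ⟨n, hn, fun y => ?_⟩
  have h₁ := abs_lt.mp (((ψ - φ).norm_coe_le_norm y).trans_lt hψφ)
  have h₂ := abs_lt.mp (hn' y)
  simp only [ContinuousMap.sub_apply] at h₁
  rw [abs_lt]
  constructor <;> linarith

theorem exists_finset_partition_of_dist_lt {X : Type*} [MetricSpace X] [CompactSpace X]
    {δ : ℝ} (hδ : 0 < δ) :
    ∃ (t : Finset X) (φ : X → C(X, ℝ)), (∀ x y, 0 ≤ φ x y) ∧
      (∀ y, ∑ x ∈ t, φ x y = 1) ∧ ∀ x y, φ x y ≠ 0 → dist y x < δ := by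
  obtain ⟨s, -, hs, hcov⟩ := (isCompact_univ (X := X)).finite_cover_balls hδ
  let b : X → X → ℝ := fun x y => max 0 (δ - dist y x)
  have hb : ∀ x y, 0 ≤ b x y := fun x y => le_max_left _ _
  have hpos : ∀ y, 0 < ∑ x ∈ hs.toFinset, b x y := by
    intro y
    obtain ⟨x, hx, hxy⟩ := Set.mem_iUnion₂.mp (hcov (Set.mem_univ y))
    exact Finset.sum_pos' (fun x _ => hb x y)
      ⟨x, hs.mem_toFinset.mpr hx, lt_max_of_lt_right (sub_pos.mpr hxy)⟩
  refine ⟨hs.toFinset, fun x => ⟨fun y => b x y / ∑ z ∈ hs.toFinset, b z y, ?_⟩, ?_, ?_, ?_⟩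
  · exact Continuous.div (by fun_prop) (by fun_prop) fun y => (hpos y).ne'
  · exact fun x y => div_nonneg (hb x y) (hpos y).le
  · intro y
    simp only [ContinuousMap.coe_mk, ← Finset.sum_div]
    exact div_self (hpos y).ne'
  · intro x y hxy
    by_contra! h
    exact hxy (by simp [b, h])

theorem IsCompact.exists_dist_lt_continuousMap {X : Type*} [MetricSpace X] [CompactSpace X]
    {U : Set C(X, ℝ)} (hU : IsCompact U) {ε : ℝ} (hε : 0 < ε) :
    ∃ δ > 0, ∀ f ∈ U, ∀ x y, dist x y < δ → |f x - f y| < ε := by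
  have : CompactSpace U := isCompact_iff_compactSpace.mp hU
  have huc : UniformContinuous fun q : U × X => (q.1 : C(X, ℝ)) q.2 :=
    CompactSpace.uniformContinuous_of_continuous (by fun_prop)
  obtain ⟨δ, hδ, h⟩ := Metric.uniformContinuous_iff.mp huc ε hε
  refine ⟨δ, hδ, fun f hf x y hxy => ?_⟩
  simpa [Real.dist_eq] using
    h (a := (⟨f, hf⟩, x)) (b := (⟨f, hf⟩, y)) (by simp [Prod.dist_eq, hxy])

theorem IsCompact.exists_near_sum_eval_mul {X : Type*} [MetricSpace X] [CompactSpace X]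
    {U : Set C(X, ℝ)} (hU : IsCompact U) {ε : ℝ} (hε : 0 < ε) :
    ∃ (t : Finset X) (φ : X → C(X, ℝ)), ∀ f ∈ U, ∀ y,
      |f y - ∑ x ∈ t, f x * φ x y| ≤ ε := by
  obtain ⟨δ, hδ, h⟩ := hU.exists_dist_lt_continuousMap hε
  obtain ⟨t, φ, hφ, hsum, hsupp⟩ := exists_finset_partition_of_dist_lt (X := X) hδ
  refine ⟨t, φ, fun f hf y => ?_⟩
  calc |f y - ∑ x ∈ t, f x * φ x y|
      = |∑ x ∈ t, (f y - f x) * φ x y| := by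
        simp only [sub_mul, Finset.sum_sub_distrib, ← Finset.mul_sum, hsum, mul_one]
    _ ≤ ∑ x ∈ t, ε * φ x y := by
        refine (Finset.abs_sum_le_sum_abs _ _).trans (Finset.sum_le_sum fun x _ => ?_)
        rw [abs_mul, abs_of_nonneg (hφ x y)]
        by_cases hx : φ x y = 0
        · simp [hx]
        · exact mul_le_mul_of_nonneg_right (h f hf y x (hsupp x y hx)).le (hφ x y)
    _ = ε := by rw [← Finset.mul_sum, hsum, mul_one]

/-- Chen & Chen, Theorem 3 (Lemma 1 of the paper): every function in a compact family
`U ⊂ C(H)` can be uniformly approximated by a single shared one-hidden-layer neural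
network basis `g(w_k ⋅ y + p_k)`, with coefficients given by continuous linear
functionals `c_k` on `C(H)`. -/
theorem shared_basis_universal_approximation
    {d : ℕ} (g : ℝ → ℝ) (hg : IsTauberWiener g)
    (H : Set (Fin d → ℝ)) (hH : IsCompact H)
    (U : Set C(↥H, ℝ)) (hU : IsCompact U)
    (ε : ℝ) (hε : 0 < ε) :
    ∃ (K : ℕ), 0 < K ∧
      ∃ (c : Fin K → (C(↥H, ℝ) →L[ℝ] ℝ)) (w : Fin K → Fin d → ℝ) (p : Fin K → ℝ),
        ∀ f ∈ U, ∀ y : ↥H,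
          |f y - ∑ k, c k f * g ((∑ j, w k j * (y : Fin d → ℝ) j) + p k)| < ε := by
  have : CompactSpace H := isCompact_iff_compactSpace.mp hH
  obtain ⟨t, φ, hφ⟩ := hU.exists_near_sum_eval_mul (half_pos hε)
  obtain ⟨M, hM, hUM⟩ := hU.isBounded.exists_pos_norm_le
  have hη : 0 < ε / 2 / (M * (t.card + 1)) := by positivity
  have hnet : ∀ x : t, ∃ (n : ℕ) (a : Fin n → ℝ) (q : Fin n → (Fin d → ℝ) × ℝ), ∀ y : H,
      |φ x y - ∑ i, a i * g ((∑ j, (q i).1 j * (y : Fin d → ℝ) j) + (q i).2)|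
        < ε / 2 / (M * (t.card + 1)) := by
    intro x
    obtain ⟨m, hm, hm'⟩ := exists_ridgeSpan_near hg hH (φ x) hη
    obtain ⟨n, a, s, rfl⟩ := Submodule.mem_span_set'.mp hm
    choose q hq using fun i => (s i).2
    refine ⟨n, a, q, fun y => ?_⟩
    simpa [← hq] using hm' y
  choose n a q hnet using hnet
  let e := Fintype.equivFin (Option (Σ x : t, Fin (n x)))
  let c : Option (Σ x : t, Fin (n x)) → (C(H, ℝ) →L[ℝ] ℝ) := fun k =>
    k.elim 0 fun k => a k.1 k.2 • ContinuousMap.evalCLM ℝ (k.1 : H)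
  let r : Option (Σ x : t, Fin (n x)) → (Fin d → ℝ) × ℝ := fun k => k.elim 0 fun k => q k.1 k.2
  refine ⟨_, Fintype.card_pos, fun k => c (e.symm k), fun k => (r (e.symm k)).1,
    fun k => (r (e.symm k)).2, fun f hf y => ?_⟩
  rw [e.symm.sum_comp fun k => c k f * g ((∑ j, (r k).1 j * (y : Fin d → ℝ) j) + (r k).2),
    Fintype.sum_option, Fintype.sum_sigma]
  let m : t → ℝ := fun x =>
    ∑ i, a x i * g ((∑ j, (q x i).1 j * (y : Fin d → ℝ) j) + (q x i).2)
  have hsum : c none f * g ((∑ j, (r none).1 j * (y : Fin d → ℝ) j) + (r none).2) +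
      ∑ x : t, ∑ i : Fin (n x), c (some ⟨x, i⟩) f *
        g ((∑ j, (r (some ⟨x, i⟩)).1 j * (y : Fin d → ℝ) j) + (r (some ⟨x, i⟩)).2) =
      ∑ x : t, f x * m x := by
    simp [c, r, m, Finset.mul_sum, mul_assoc, mul_left_comm]
  rw [hsum]
  have h₁ := hφ f hf y
  rw [← Finset.sum_coe_sort t] at h₁
  have h₂ : |∑ x : t, f x * φ x y - ∑ x : t, f x * m x| < ε / 2 := by
    rw [← Finset.sum_sub_distrib]
    calc |∑ x : t, (f x * φ x y - f x * m x)|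
        ≤ ∑ _x : t, M * (ε / 2 / (M * (t.card + 1))) := by
          refine (Finset.abs_sum_le_sum_abs _ _).trans (Finset.sum_le_sum fun x _ => ?_)
          rw [← mul_sub, abs_mul]
          exact mul_le_mul ((f.norm_coe_le_norm x).trans (hUM f hf)) (hnet x y).le
            (abs_nonneg _) hM.le
      _ = ε / 2 * (t.card / (t.card + 1)) := by
          simp only [Finset.sum_const, Finset.card_univ, Fintype.card_coe, nsmul_eq_mul]
          field_simp
      _ < ε / 2 := by
          refine mul_lt_of_lt_one_right (half_pos hε) ?_
          rw [div_lt_one (by positivity)]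
          exact lt_add_one _
  have h₃ := abs_sub_le (f y) (∑ x : t, f x * φ x y) (∑ x : t, f x * m x)
  linarith
end

section
/- Let g : ℝ → ℝ be a Tauber-Wiener function. Let K₁' and K₂' be Banach spaces, K₁ ⊂ K₁' and K₂ ⊂ K₂' compact sets, V₁ ⊂ C(K₁) and V₂ ⊂ C(K₂) compact sets of continuous functions, K_x ⊂ ℝ^d a compact set, and G₁ : V₁ → C(K_x) and G₂ : V₂ → C(K_x) continuous operators. Set U = G₁(V₁) ∪ G₂(V₂) ⊂ C(K_x). Then U is compact in C(K_x), and for every ε > 0 there exist a positive integer K, continuous linear functionals a_1, …, a_K on C(K_x), weight vectors ω_1, …, ω_K ∈ ℝ^d, and biases ζ_1, …, ζ_K ∈ ℝ, such that for every c ∈ {1, 2}, every u ∈ V_c, and every x ∈ K_x, |G_c(u)(x) − ∑_{k=1}^K a_k(G_c(u)) · g(ω_k · x + ζ_k)| < ε, with the same functionals a_k and trunk networks g(ω_k · x + ζ_k) serving both operators simultaneously. -/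
/-- The real functions on `X` that are uniform limits of elements of a submodule of `X → ℝ`. -/
def IsUniformlyApproximable {X : Type*} (S : Submodule ℝ (X → ℝ)) (φ : X → ℝ) : Prop :=
  ∀ ε : ℝ, 0 < ε → ∃ s ∈ S, ∀ x, |φ x - s x| < ε

namespace IsUniformlyApproximable

variable {X : Type*} {S : Submodule ℝ (X → ℝ)} {φ ψ : X → ℝ}

theorem zero : IsUniformlyApproximable S 0 := fun ε hε =>
  ⟨0, S.zero_mem, fun x => by simpa using hε⟩

theorem add (hφ : IsUniformlyApproximable S φ) (hψ : IsUniformlyApproximable S ψ) :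
    IsUniformlyApproximable S (φ + ψ) := by
  intro ε hε
  obtain ⟨s, hs, h1⟩ := hφ (ε / 2) (half_pos hε)
  obtain ⟨t, ht, h2⟩ := hψ (ε / 2) (half_pos hε)
  refine ⟨s + t, S.add_mem hs ht, fun x => ?_⟩
  have h3 : (φ + ψ) x - (s + t) x = (φ x - s x) + (ψ x - t x) := by
    simp only [Pi.add_apply]; ring
  rw [h3]
  linarith [abs_add_le (φ x - s x) (ψ x - t x), h1 x, h2 x]

theorem smul (c : ℝ) (hφ : IsUniformlyApproximable S φ) :
    IsUniformlyApproximable S (c • φ) := by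
  intro ε hε
  have hc : 0 < |c| + 1 := by positivity
  obtain ⟨s, hs, h1⟩ := hφ (ε / (|c| + 1)) (div_pos hε hc)
  refine ⟨c • s, S.smul_mem c hs, fun x => ?_⟩
  have h2 := h1 x
  rw [lt_div_iff₀ hc] at h2
  have h3 : (c • φ) x - (c • s) x = c * (φ x - s x) := by
    simp only [Pi.smul_apply, smul_eq_mul]; ring
  rw [h3, abs_mul]
  nlinarith [abs_nonneg (φ x - s x)]

theorem of_forall_approx
    (h : ∀ ε : ℝ, 0 < ε → ∃ ψ, IsUniformlyApproximable S ψ ∧ ∀ x, |φ x - ψ x| < ε) :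
    IsUniformlyApproximable S φ := by
  intro ε hε
  obtain ⟨ψ, hψ, h1⟩ := h (ε / 2) (half_pos hε)
  obtain ⟨s, hs, h2⟩ := hψ (ε / 2) (half_pos hε)
  exact ⟨s, hs, fun x => by linarith [abs_sub_le (φ x) (ψ x) (s x), h1 x, h2 x]⟩

end IsUniformlyApproximable

/-- The characters `x ↦ exp (w ⬝ᵥ x)` on a subset of `ℝ^d`, multiplicative in `w`. -/
noncomputable def expDotHom {d : ℕ} (X : Set (Fin d → ℝ)) :
    Multiplicative (Fin d → ℝ) →* C(X, ℝ) where
  toFun w := ⟨fun x => Real.exp (w.toAdd ⬝ᵥ (x : Fin d → ℝ)),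
    Real.continuous_exp.comp (continuous_const.dotProduct continuous_subtype_val)⟩
  map_one' := by ext x; simp
  map_mul' v w := by ext x; simp [add_dotProduct, Real.exp_add]

theorem expDotHom_apply {d : ℕ} (X : Set (Fin d → ℝ)) (w : Multiplicative (Fin d → ℝ)) (x : X) :
    expDotHom X w x = Real.exp (w.toAdd ⬝ᵥ (x : Fin d → ℝ)) := rfl

theorem dense_span_range_expDotHom {d : ℕ} (X : Set (Fin d → ℝ)) [CompactSpace X] :
    Dense (Submodule.span ℝ (Set.range (expDotHom X)) : Set C(X, ℝ)) := by
  have hspan : Submodule.span ℝ (Set.range (expDotHom X)) =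
      Subalgebra.toSubmodule (Algebra.adjoin ℝ (Set.range (expDotHom X))) := by
    rw [Algebra.adjoin_eq_span, ← MonoidHom.coe_mrange, Submonoid.closure_eq]
  have hsep : (Algebra.adjoin ℝ (Set.range (expDotHom X))).SeparatesPoints := by
    intro x y hxy
    obtain ⟨j, hj⟩ : ∃ j, (x : Fin d → ℝ) j ≠ (y : Fin d → ℝ) j :=
      Function.ne_iff.mp fun h => hxy (Subtype.ext h)
    refine ⟨_, ⟨_, Algebra.subset_adjoin ⟨Multiplicative.ofAdd (Pi.single j 1), rfl⟩, rfl⟩, ?_⟩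
    simpa [expDotHom_apply] using hj
  have htop := ContinuousMap.subalgebra_topologicalClosure_eq_top_of_separatesPoints _ hsep
  rw [hspan, dense_iff_closure_eq]
  exact congrArg (fun A : Subalgebra ℝ C(X, ℝ) => (A : Set C(X, ℝ))) htop

/-- The ridge function on `X ⊆ ℝ^d` with activation `g`, weight `p.1` and bias `p.2`. -/
def ridge {d : ℕ} (g : ℝ → ℝ) (X : Set (Fin d → ℝ)) (p : (Fin d → ℝ) × ℝ) (x : X) : ℝ :=
  g (p.1 ⬝ᵥ (x : Fin d → ℝ) + p.2)

theorem IsTauberWiener.approximable_comp_dotProduct {d : ℕ} {g : ℝ → ℝ} (hg : IsTauberWiener g)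
    (X : Set (Fin d → ℝ)) [CompactSpace X] {f : ℝ → ℝ} (hf : Continuous f) (w : Fin d → ℝ) :
    IsUniformlyApproximable (Submodule.span ℝ (Set.range (ridge g X)))
      (fun x => f (w ⬝ᵥ (x : Fin d → ℝ))) := by
  intro ε hε
  have hcont : Continuous fun x : X => w ⬝ᵥ (x : Fin d → ℝ) :=
    continuous_const.dotProduct continuous_subtype_val
  obtain ⟨M, hM⟩ := (isCompact_range hcont).isBounded.exists_norm_le
  obtain ⟨N, -, c, lam, θ, h⟩ := hg (-M) M f hf.continuousOn ε hε
  refine ⟨∑ i, c i • ridge g X (lam i • w, θ i), Submodule.sum_mem _ fun i _ =>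
    Submodule.smul_mem _ _ (Submodule.subset_span ⟨_, rfl⟩), fun x => ?_⟩
  have hx := h (w ⬝ᵥ (x : Fin d → ℝ)) (abs_le.mp (hM _ ⟨x, rfl⟩))
  simpa [ridge, smul_dotProduct] using hx

theorem IsTauberWiener.approximable {d : ℕ} {g : ℝ → ℝ} (hg : IsTauberWiener g)
    (X : Set (Fin d → ℝ)) [CompactSpace X] (φ : C(X, ℝ)) :
    IsUniformlyApproximable (Submodule.span ℝ (Set.range (ridge g X))) φ := by
  refine .of_forall_approx fun ε hε => ?_
  obtain ⟨ψ, hψ, hdist⟩ := (dense_span_range_expDotHom X).exists_dist_lt φ hε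
  refine ⟨ψ, ?_, fun x => (ContinuousMap.dist_apply_le_dist x).trans_lt hdist⟩
  clear hdist
  induction hψ using Submodule.span_induction with
  | mem ψ h =>
    obtain ⟨w, rfl⟩ := h
    exact hg.approximable_comp_dotProduct X Real.continuous_exp w.toAdd
  | zero => exact .zero
  | add _ _ _ _ h1 h2 => exact h1.add h2
  | smul c _ _ h => exact h.smul c

/-- A compact set of continuous functions on a compact Hausdorff space is uniformly approximated
by an operator of finite rank built from point evaluations. -/
theorem IsCompact.exists_finite_sum_eval_approx {X : Type*} [TopologicalSpace X] [CompactSpace X]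
    [T2Space X] {U : Set C(X, ℝ)} (hU : IsCompact U) {ε : ℝ} (hε : 0 < ε) :
    ∃ (t : Finset X) (ρ : t → C(X, ℝ)), ∀ f ∈ U, ∀ x, |f x - ∑ i : t, f i * ρ i x| ≤ ε := by
  have hnhds : ∀ x : X, ∃ V : Set X, IsOpen V ∧ x ∈ V ∧ ∀ f ∈ U, ∀ y ∈ V, |f y - f x| < ε := by
    intro x
    have hopen : IsOpen {p : C(X, ℝ) × X | |p.1 p.2 - p.1 x| < ε} :=
      isOpen_lt (by fun_prop) continuous_const
    obtain ⟨A, V, -, hV, hUA, hxV, hsub⟩ := generalized_tube_lemma hU (isCompact_singleton (x := x))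
      hopen (by rintro ⟨f, y⟩ ⟨-, rfl⟩; simpa using hε)
    exact ⟨V, hV, hxV rfl, fun f hf y hy => hsub (Set.mk_mem_prod (hUA hf) hy)⟩
  choose V hVo hVx hV using hnhds
  obtain ⟨t, ht⟩ := isCompact_univ.elim_finite_subcover V hVo
    fun x _ => Set.mem_iUnion.mpr ⟨x, hVx x⟩
  obtain ⟨ρ, hρ⟩ := PartitionOfUnity.exists_isSubordinate isClosed_univ
    (fun i : t => V i) (fun i => hVo i) (by simpa [Set.iUnion_subtype] using ht)
  refine ⟨t, fun i => ρ i, fun f hf x => ?_⟩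
  have hsum : ∑ i, ρ i x = 1 := by
    rw [← finsum_eq_sum_of_fintype]; exact ρ.sum_eq_one (Set.mem_univ x)
  have hterm : ∀ i : t, |(f x - f i) * ρ i x| ≤ ε * ρ i x := by
    intro i
    rw [abs_mul, abs_of_nonneg (ρ.nonneg i x)]
    by_cases h0 : ρ i x = 0
    · simp [h0]
    · exact mul_le_mul_of_nonneg_right
        (hV i f hf x (hρ i (subset_tsupport _ h0))).le (ρ.nonneg i x)
  calc |f x - ∑ i : t, f i * ρ i x| = |∑ i : t, (f x - f i) * ρ i x| := by
        simp only [sub_mul, Finset.sum_sub_distrib, ← Finset.mul_sum, hsum, mul_one]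
    _ ≤ ∑ i : t, |(f x - f i) * ρ i x| := Finset.abs_sum_le_sum_abs _ _
    _ ≤ ∑ i, ε * ρ i x := Finset.sum_le_sum fun i _ => hterm i
    _ = ε := by rw [← Finset.mul_sum, hsum, mul_one]

theorem IsTauberWiener.exists_functionals_approx {d : ℕ} {g : ℝ → ℝ} (hg : IsTauberWiener g)
    {X : Set (Fin d → ℝ)} [CompactSpace X] {U : Set C(X, ℝ)} (hU : IsCompact U) {ε : ℝ}
    (hε : 0 < ε) :
    ∃ (T : Finset ((Fin d → ℝ) × ℝ)) (a : (Fin d → ℝ) × ℝ → (C(X, ℝ) →L[ℝ] ℝ)),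
      T.Nonempty ∧ ∀ f ∈ U, ∀ x, |f x - ∑ p ∈ T, a p f * ridge g X p x| < ε := by
  classical
  obtain ⟨t, ρ, hρ⟩ := hU.exists_finite_sum_eval_approx (half_pos hε)
  obtain ⟨M, hM0, hM⟩ := hU.isBounded.exists_pos_norm_le
  set δ : ℝ := ε / (2 * (M * (t.card + 1))) with hδ
  have hδ0 : 0 < δ := by positivity
  choose s hs hsδ using fun i => hg.approximable X (ρ i) δ hδ0
  choose c hc using fun i => Finsupp.mem_span_range_iff_exists_finsupp.mp (hs i)
  let T : Finset ((Fin d → ℝ) × ℝ) := insert 0 (Finset.univ.biUnion fun i => (c i).support)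
  have hsT : ∀ i x, s i x = ∑ p ∈ T, c i p * ridge g X p x := by
    intro i x
    rw [← hc i, Finsupp.sum_of_support_subset (s := T) _
      ((Finset.subset_biUnion_of_mem (fun i => (c i).support) (Finset.mem_univ i)).trans
        (Finset.subset_insert _ _)) _ (by simp)]
    simp
  refine ⟨T, fun p => ∑ i, c i p • ContinuousMap.evalCLM ℝ (i : X),
    Finset.insert_nonempty _ _, fun f hf x => ?_⟩
  have heq : ∑ p ∈ T, (∑ i : t, c i p • ContinuousMap.evalCLM ℝ (i : X) : C(X, ℝ) →L[ℝ] ℝ) f *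
      ridge g X p x = ∑ i : t, f i * s i x := by
    simp only [_root_.sum_apply, _root_.smul_apply,
      ContinuousMap.evalCLM_apply, smul_eq_mul, Finset.sum_mul, hsT, Finset.mul_sum]
    rw [Finset.sum_comm]
    exact Finset.sum_congr rfl fun i _ => Finset.sum_congr rfl fun p _ => by ring
  rw [heq]
  have hsecond : |∑ i : t, f i * ρ i x - ∑ i : t, f i * s i x| < ε / 2 := by
    calc |∑ i : t, f i * ρ i x - ∑ i : t, f i * s i x| = |∑ i : t, f i * (ρ i x - s i x)| := by
          simp only [mul_sub, Finset.sum_sub_distrib]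
      _ ≤ ∑ i : t, |f i * (ρ i x - s i x)| := Finset.abs_sum_le_sum_abs _ _
      _ ≤ ∑ _i : t, M * δ := Finset.sum_le_sum fun i _ => by
          rw [abs_mul]
          exact mul_le_mul ((f.norm_coe_le_norm i).trans (hM f hf)) (hsδ i x).le
            (abs_nonneg _) hM0.le
      _ = t.card * (M * δ) := by simp
      _ < (t.card + 1) * (M * δ) := by
          have := mul_pos hM0 hδ0
          linarith
      _ = ε / 2 := by rw [hδ]; field_simp
  linarith [abs_sub_le (f x) (∑ i : t, f i * ρ i x) (∑ i : t, f i * s i x), hρ f hf x]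

/-- First intermediate step (Equation (4)) in the proof of the D2NO theorem: the union
`U = G₁(V₁) ∪ G₂(V₂)` of the two image sets is compact in `C(K_x)`, hence a single shared
trunk basis `g(ω_k ⋅ x + ζ_k)` together with a single set of continuous linear coefficient
functionals `a_k` approximates all output functions of both clients uniformly. -/
theorem d2no_shared_trunk_step
    {X₁ X₂ : Type*} [NormedAddCommGroup X₁] [NormedSpace ℝ X₁] [CompleteSpace X₁]
    [NormedAddCommGroup X₂] [NormedSpace ℝ X₂] [CompleteSpace X₂]
    {d : ℕ} (g : ℝ → ℝ) (hg : IsTauberWiener g)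
    (K₁ : Set X₁) (hK₁ : IsCompact K₁)
    (K₂ : Set X₂) (hK₂ : IsCompact K₂)
    (V₁ : Set C(↥K₁, ℝ)) (hV₁ : IsCompact V₁)
    (V₂ : Set C(↥K₂, ℝ)) (hV₂ : IsCompact V₂)
    (Kx : Set (Fin d → ℝ)) (hKx : IsCompact Kx)
    (G₁ : C(↥K₁, ℝ) → C(↥Kx, ℝ)) (hG₁ : ContinuousOn G₁ V₁)
    (G₂ : C(↥K₂, ℝ) → C(↥Kx, ℝ)) (hG₂ : ContinuousOn G₂ V₂) :
    IsCompact (G₁ '' V₁ ∪ G₂ '' V₂) ∧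
      ∀ ε : ℝ, 0 < ε →
        ∃ (K : ℕ), 0 < K ∧
          ∃ (a : Fin K → (C(↥Kx, ℝ) →L[ℝ] ℝ)) (ω : Fin K → Fin d → ℝ) (ζ : Fin K → ℝ),
            (∀ u ∈ V₁, ∀ x : ↥Kx,
              |G₁ u x -
                  ∑ k, a k (G₁ u) * g ((∑ j, ω k j * (x : Fin d → ℝ) j) + ζ k)| < ε) ∧
            (∀ u ∈ V₂, ∀ x : ↥Kx,
              |G₂ u x -
                  ∑ k, a k (G₂ u) * g ((∑ j, ω k j * (x : Fin d → ℝ) j) + ζ k)| < ε) := by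
  have hU := (hV₁.image_of_continuousOn hG₁).union (hV₂.image_of_continuousOn hG₂)
  refine ⟨hU, fun ε hε => ?_⟩
  have : CompactSpace Kx := isCompact_iff_compactSpace.mp hKx
  obtain ⟨T, a, hT, h⟩ := hg.exists_functionals_approx hU hε
  have hmain : ∀ f ∈ G₁ '' V₁ ∪ G₂ '' V₂, ∀ x : Kx,
      |f x - ∑ k : Fin T.card, a (T.equivFin.symm k) f *
        g ((∑ j, (T.equivFin.symm k : (Fin d → ℝ) × ℝ).1 j * (x : Fin d → ℝ) j) +
          (T.equivFin.symm k : (Fin d → ℝ) × ℝ).2)| < ε := by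
    intro f hf x
    have hsum := T.equivFin.symm.sum_comp fun p : T => a p f * ridge g Kx p x
    rw [Finset.sum_coe_sort T fun p => a p f * ridge g Kx p x] at hsum
    have hx := h f hf x
    rw [← hsum] at hx
    exact hx
  exact ⟨T.card, hT.card_pos, fun k => a (T.equivFin.symm k),
    fun k => (T.equivFin.symm k : (Fin d → ℝ) × ℝ).1,
    fun k => (T.equivFin.symm k : (Fin d → ℝ) × ℝ).2,
    fun u hu => hmain _ (Or.inl ⟨u, hu, rfl⟩), fun u hu => hmain _ (Or.inr ⟨u, hu, rfl⟩)⟩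
end
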